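/- arXiv:1203.0100 — 4 statements merged into one kernel-verified Lean document; each statement's English description precedes it below -/
import Mathlib

section
/- Given a cake cutting situation with piecewise linear preferences, a utilitarian optimal allocation exists: if each agent i's density t_i is piecewise linear (there is a finite partition of [0,1] into intervals on each of which t_i is an affine function), then among allocations whose portions are finite unions of closed intervals there exists an allocation A maximizing UE(A) = Σ_{i=1}^n ∫_{A_i} t_i. -/
open MeasureTheory

/-- A finite union of closed intervals. -/
def FinUnionIcc (A : Set ℝ) : Prop :=
  ∃ (m : ℕ) (a b : Fin m → ℝ), A = ⋃ k, Set.Icc (a k) (b k)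

/-- An allocation whose portions are finite unions of closed intervals inside `[0,1]`,
pairwise disjoint up to boundary points (null overlap). -/
def IsFUAllocation {n : ℕ} (A : Fin n → Set ℝ) : Prop :=
  (∀ i, A i ⊆ Set.Icc 0 1) ∧ (∀ i, FinUnionIcc (A i)) ∧
    ∀ i j, i ≠ j → volume (A i ∩ A j) = 0

/-- A density on `[0,1]` is piecewise linear if `[0,1]` can be cut into finitely many
intervals on each of which it is an affine function. -/
def PiecewiseLinear (f : ℝ → ℝ) : Prop :=
  ∃ (m : ℕ) (x : Fin (m+1) → ℝ), 0 < m ∧ x 0 = 0 ∧ x (Fin.last m) = 1 ∧ Monotone x ∧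
    ∀ k : Fin m, ∃ c d : ℝ, ∀ y ∈ Set.Ico (x k.castSucc) (x k.succ), f y = c * y + d

theorem finUnionIcc_iUnion_Icc {ι : Type*} [Finite ι] (a b : ι → ℝ) :
    FinUnionIcc (⋃ i, Set.Icc (a i) (b i)) := by
  obtain ⟨m, ⟨e⟩⟩ := Finite.exists_equiv_fin ι
  exact ⟨m, a ∘ e.symm, b ∘ e.symm,
    (e.symm.surjective.iUnion_comp fun i => Set.Icc (a i) (b i)).symm⟩

theorem finUnionIcc_Icc (a b : ℝ) : FinUnionIcc (Set.Icc a b) := by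
  simpa only [Set.iUnion_const] using
    finUnionIcc_iUnion_Icc (fun _ : Unit => a) (fun _ : Unit => b)

theorem FinUnionIcc.iUnion {ι : Type*} [Finite ι] {A : ι → Set ℝ}
    (hA : ∀ i, FinUnionIcc (A i)) : FinUnionIcc (⋃ i, A i) := by
  choose m a b h using hA
  have := finUnionIcc_iUnion_Icc (fun p : Σ i, Fin (m i) => a p.1 p.2) (fun p => b p.1 p.2)
  rwa [Set.iUnion_sigma, ← Set.iUnion_congr h] at this

theorem FinUnionIcc.inter {A B : Set ℝ} (hA : FinUnionIcc A) (hB : FinUnionIcc B) :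
    FinUnionIcc (A ∩ B) := by
  obtain ⟨m, a, b, rfl⟩ := hA
  obtain ⟨m', a', b', rfl⟩ := hB
  simp only [Set.iUnion_inter, Set.inter_iUnion, Set.Icc_inter_Icc]
  exact .iUnion fun _ => finUnionIcc_iUnion_Icc _ _

theorem FinUnionIcc.measurableSet {A : Set ℝ} (hA : FinUnionIcc A) : MeasurableSet A := by
  obtain ⟨m, a, b, rfl⟩ := hA
  exact .iUnion fun _ => measurableSet_Icc

/-- A set that agrees almost everywhere with a finite union of closed intervals. -/
def AEFinUnionIcc (S : Set ℝ) : Prop :=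
  ∃ C, FinUnionIcc C ∧ C =ᵐ[volume] S

theorem AEFinUnionIcc.inter {S T : Set ℝ} (hS : AEFinUnionIcc S) (hT : AEFinUnionIcc T) :
    AEFinUnionIcc (S ∩ T) := by
  obtain ⟨C, hC, hCS⟩ := hS
  obtain ⟨D, hD, hDT⟩ := hT
  exact ⟨C ∩ D, hC.inter hD, ae_eq_set_inter hCS hDT⟩

theorem AEFinUnionIcc.iUnion {ι : Type*} [Finite ι] {S : ι → Set ℝ}
    (hS : ∀ i, AEFinUnionIcc (S i)) : AEFinUnionIcc (⋃ i, S i) := by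
  choose C hC hCS using hS
  exact ⟨⋃ i, C i, .iUnion hC, Filter.EventuallyEq.countable_iUnion hCS⟩

theorem AEFinUnionIcc.inter_iInter {ι : Type*} [Finite ι] {T : Set ℝ} {S : ι → Set ℝ}
    (hT : AEFinUnionIcc T) (hS : ∀ i, AEFinUnionIcc (S i)) :
    AEFinUnionIcc (T ∩ ⋂ i, S i) := by
  have := Fintype.ofFinite ι
  have h : ∀ s : Finset ι, AEFinUnionIcc (T ∩ ⋂ i ∈ s, S i) := by
    classical
    intro s
    induction s using Finset.induction with
    | empty => simpa using hT
    | insert i s _ ih =>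
      rw [Finset.set_biInter_insert, Set.inter_left_comm]
      exact (hS i).inter ih
  simpa using h Finset.univ

theorem Set.OrdConnected.aeFinUnionIcc {S : Set ℝ} (hS : S.OrdConnected)
    (hb : BddBelow S) (ha : BddAbove S) : AEFinUnionIcc S := by
  rcases S.eq_empty_or_nonempty with rfl | hne
  · exact ⟨Set.Icc 1 0, finUnionIcc_Icc _ _, by simp⟩
  refine ⟨Set.Icc (sInf S) (sSup S), finUnionIcc_Icc _ _, ?_⟩
  have hIoo : Set.Ioo (sInf S) (sSup S) ⊆ S := fun x hx => by
    obtain ⟨y, hy, hyx⟩ := exists_lt_of_csInf_lt hne hx.1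
    obtain ⟨z, hz, hxz⟩ := exists_lt_of_lt_csSup hne hx.2
    exact hS.out hy hz ⟨hyx.le, hxz.le⟩
  exact (Ioo_ae_eq_Icc.symm.le.trans (LE.le.eventuallyLE hIoo)).antisymm
    (LE.le.eventuallyLE (subset_Icc_csInf_csSup hb ha))

theorem aeFinUnionIcc_Ico (a b : ℝ) : AEFinUnionIcc (Set.Ico a b) :=
  Set.ordConnected_Ico.aeFinUnionIcc bddBelow_Ico bddAbove_Ico

theorem Set.OrdConnected.preimage_affine {s : Set ℝ} (hs : s.OrdConnected) (c d : ℝ) :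
    {y : ℝ | c * y + d ∈ s}.OrdConnected := by
  rcases le_total 0 c with hc | hc
  · exact hs.preimage_mono fun x y h => by gcongr
  · exact hs.preimage_anti fun x y h =>
      add_le_add_left (mul_le_mul_of_nonpos_left h hc) d

theorem exists_mem_Ico_castSucc_succ {m : ℕ} (x : Fin (m + 1) → ℝ) {y : ℝ}
    (h0 : x 0 ≤ y) (h1 : y < x (Fin.last m)) :
    ∃ k : Fin m, y ∈ Set.Ico (x k.castSucc) (x k.succ) := by
  by_contra! h
  have hle : ∀ k, x k ≤ y := Fin.induction h0 fun k hk => not_lt.1 fun hlt => h k ⟨hk, hlt⟩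
  exact (hle _).not_gt h1

/-- The locus where the difference of two piecewise linear functions lies in a given
order-connected set agrees almost everywhere with a finite union of closed intervals. -/
theorem PiecewiseLinear.aeFinUnionIcc_sub_mem {f g : ℝ → ℝ} (hf : PiecewiseLinear f)
    (hg : PiecewiseLinear g) {s : Set ℝ} (hs : s.OrdConnected) :
    AEFinUnionIcc {y ∈ Set.Ico (0 : ℝ) 1 | f y - g y ∈ s} := by
  obtain ⟨m, x, -, hx0, hx1, hx, hf⟩ := hf
  obtain ⟨m', x', -, hx0', hx1', hx', hg⟩ := hg
  choose c d hcd using hf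
  choose c' d' hcd' using hg
  have key : {y ∈ Set.Ico (0 : ℝ) 1 | f y - g y ∈ s} = ⋃ p : Fin m × Fin m',
      Set.Ico (x p.1.castSucc) (x p.1.succ) ∩ Set.Ico (x' p.2.castSucc) (x' p.2.succ) ∩
        {y | (c p.1 - c' p.2) * y + (d p.1 - d' p.2) ∈ s} := by
    have aux : ∀ {k l y}, y ∈ Set.Ico (x k.castSucc) (x k.succ) →
        y ∈ Set.Ico (x' l.castSucc) (x' l.succ) →
        f y - g y = (c k - c' l) * y + (d k - d' l) := fun hk hl => by
      rw [hcd _ _ hk, hcd' _ _ hl]; ring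
    ext y
    simp only [Set.mem_ofPred_eq, Set.mem_iUnion, Set.mem_inter_iff, Prod.exists]
    constructor
    · rintro ⟨hy, hys⟩
      obtain ⟨k, hk⟩ := exists_mem_Ico_castSucc_succ x (hx0.trans_le hy.1) (hy.2.trans_eq hx1.symm)
      obtain ⟨l, hl⟩ :=
        exists_mem_Ico_castSucc_succ x' (hx0'.trans_le hy.1) (hy.2.trans_eq hx1'.symm)
      exact ⟨k, l, ⟨hk, hl⟩, aux hk hl ▸ hys⟩
    · rintro ⟨k, l, ⟨hk, hl⟩, hys⟩
      refine ⟨⟨?_, ?_⟩, (aux hk hl).symm ▸ hys⟩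
      · exact hx0 ▸ (hx (Fin.zero_le _)).trans hk.1
      · exact hx1 ▸ hk.2.trans_le (hx (Fin.le_last _))
  rw [key]
  refine .iUnion fun p => ?_
  exact ((Set.ordConnected_Ico.inter Set.ordConnected_Ico).inter
    (hs.preimage_affine _ _)).aeFinUnionIcc
    (bddBelow_Ico.mono fun _ h => h.1.1) (bddAbove_Ico.mono fun _ h => h.1.1)

/-- The points of `[0,1)` where agent `i` is the first among those of maximal density. -/
def firstMaximizer {n : ℕ} (t : Fin n → ℝ → ℝ) (i : Fin n) : Set ℝ :=
  {y ∈ Set.Ico (0 : ℝ) 1 | ∀ j, if j < i then t j y < t i y else t j y ≤ t i y}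

theorem le_of_mem_firstMaximizer {n : ℕ} {t : Fin n → ℝ → ℝ} {i : Fin n} {y : ℝ}
    (h : y ∈ firstMaximizer t i) (j : Fin n) : t j y ≤ t i y := by
  have := h.2 j
  split_ifs at this
  exacts [this.le, this]

theorem exists_mem_firstMaximizer {n : ℕ} (t : Fin n → ℝ → ℝ) [Nonempty (Fin n)] {y : ℝ}
    (hy : y ∈ Set.Ico (0 : ℝ) 1) : ∃ i, y ∈ firstMaximizer t i := by
  obtain ⟨i, hi, hmin⟩ := (Set.toFinite {i | ∀ j, t j y ≤ t i y}).exists_minimal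
    (Finite.exists_max fun i => t i y)
  refine ⟨i, hy, fun j => ?_⟩
  split_ifs with hji
  · exact (hi j).lt_of_ne fun h => hji.not_ge (hmin (fun k => h ▸ hi k) hji.le)
  · exact hi j

theorem firstMaximizer_inter {n : ℕ} (t : Fin n → ℝ → ℝ) {i j : Fin n} (hij : i ≠ j) :
    firstMaximizer t i ∩ firstMaximizer t j = ∅ := by
  wlog h : i < j generalizing i j
  · rw [Set.inter_comm]
    exact this hij.symm (hij.symm.lt_of_le (not_lt.1 h))
  refine Set.eq_empty_of_forall_notMem fun y hy => ?_
  have := hy.2.2 i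
  rw [if_pos h] at this
  exact this.not_ge (le_of_mem_firstMaximizer hy.1 j)

theorem aeFinUnionIcc_firstMaximizer {n : ℕ} {t : Fin n → ℝ → ℝ}
    (hpl : ∀ i, PiecewiseLinear (t i)) (i : Fin n) : AEFinUnionIcc (firstMaximizer t i) := by
  have key : firstMaximizer t i = Set.Ico 0 1 ∩ ⋂ j, {y ∈ Set.Ico (0 : ℝ) 1 |
      t i y - t j y ∈ if j < i then Set.Ioi 0 else Set.Ici 0} := by
    ext y
    simp only [firstMaximizer, Set.mem_ofPred_eq, Set.mem_inter_iff, Set.mem_iInter]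
    refine and_congr_right fun hy => forall_congr' fun j => ?_
    split_ifs <;> simp [hy.1, hy.2]
  rw [key]
  refine (aeFinUnionIcc_Ico 0 1).inter_iInter fun j => (hpl i).aeFinUnionIcc_sub_mem (hpl j) ?_
  split_ifs
  exacts [Set.ordConnected_Ioi, Set.ordConnected_Ici]

theorem IsFUAllocation.sum_setIntegral_eq {n : ℕ} {t : Fin n → ℝ → ℝ}
    (hint : ∀ i, IntegrableOn (t i) (Set.Icc 0 1)) {A : Fin n → Set ℝ} (hA : IsFUAllocation A) :
    Integrable (fun x => ∑ i, (A i).indicator (t i) x) ∧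
      ∑ i, ∫ x in A i, t i x = ∫ x, ∑ i, (A i).indicator (t i) x := by
  have h : ∀ i, Integrable ((A i).indicator (t i)) := fun i =>
    ((hint i).mono_set (hA.1 i)).integrable_indicator (hA.2.1 i).measurableSet
  refine ⟨integrable_finsetSum _ fun i _ => h i, ?_⟩
  rw [integral_finsetSum _ fun i _ => h i]
  exact Finset.sum_congr rfl fun i _ => (integral_indicator (hA.2.1 i).measurableSet).symm

/-- Given a cake cutting situation with piecewise linear preferences, a utilitarian optimal
allocation exists among allocations of finite unions of closed intervals. -/
theorem piecewise_linear_utilitarian_optimum_exists {n : ℕ}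
    (t : Fin n → ℝ → ℝ)
    (ht0 : ∀ i x, 0 ≤ t i x)
    (hint : ∀ i, IntegrableOn (t i) (Set.Icc 0 1))
    (hone : ∀ i, ∫ x in Set.Icc (0:ℝ) 1, t i x = 1)
    (hpl : ∀ i, PiecewiseLinear (t i)) :
    ∃ A : Fin n → Set ℝ, IsFUAllocation A ∧
      ∀ B : Fin n → Set ℝ, IsFUAllocation B →
        ∑ i, ∫ x in B i, t i x ≤ ∑ i, ∫ x in A i, t i x := by
  choose C hC hCW using aeFinUnionIcc_firstMaximizer hpl
  have hAW : ∀ i, (C i ∩ Set.Icc 0 1 : Set ℝ) =ᵐ[volume] firstMaximizer t i := fun i => by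
    have := ae_eq_set_inter (hCW i) (ae_eq_refl (Set.Icc (0 : ℝ) 1))
    rwa [Set.inter_eq_left (s := firstMaximizer t i).2 fun y hy => Set.Ico_subset_Icc_self hy.1] at this
  have hA : IsFUAllocation fun i => C i ∩ Set.Icc 0 1 := by
    refine ⟨fun i => Set.inter_subset_right, fun i => (hC i).inter (finUnionIcc_Icc 0 1),
      fun i j hij => ?_⟩
    rw [measure_congr (ae_eq_set_inter (hAW i) (hAW j)), firstMaximizer_inter t hij, measure_empty]
  refine ⟨_, hA, fun B hB => ?_⟩
  obtain ⟨hAi, hAe⟩ := hA.sum_setIntegral_eq hint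
  obtain ⟨hBi, hBe⟩ := hB.sum_setIntegral_eq hint
  rw [hAe, hBe]
  refine integral_mono_ae hBi hAi ?_
  have hBd : ∀ᵐ x, ∀ i j, i ≠ j → x ∉ B i ∩ B j :=
    ae_all_iff.2 fun i => ae_all_iff.2 fun j => by
      by_cases hij : i = j
      · simp [hij]
      · filter_upwards [measure_eq_zero_iff_ae_notMem.1 (hB.2.2 i j hij)] with x hx _ using hx
  have hne : ∀ᵐ x : ℝ, x ≠ 1 := Measure.ae_ne volume 1
  filter_upwards [hBd, hne, ae_all_iff.2 fun i => (hAW i).mem_iff] with x hx hx1 hxA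
  have hnn : ∀ i, 0 ≤ (C i ∩ Set.Icc 0 1).indicator (t i) x := fun i =>
    Set.indicator_nonneg (fun y _ => ht0 i y) x
  by_cases hxB : ∃ i, x ∈ B i
  · obtain ⟨i, hi⟩ := hxB
    have : Nonempty (Fin n) := ⟨i⟩
    have hx01 := hB.1 i hi
    obtain ⟨j, hj⟩ := exists_mem_firstMaximizer t ⟨hx01.1, hx01.2.lt_of_ne hx1⟩
    calc ∑ k, (B k).indicator (t k) x = t i x := by
          rw [Finset.sum_eq_single_of_mem i (Finset.mem_univ i), Set.indicator_of_mem hi]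
          exact fun k _ hki => Set.indicator_of_notMem (fun hk => hx k i hki ⟨hk, hi⟩) _
      _ ≤ t j x := le_of_mem_firstMaximizer hj i
      _ = (C j ∩ Set.Icc 0 1).indicator (t j) x :=
          (Set.indicator_of_mem ((hxA j).2 hj) _).symm
      _ ≤ _ := Finset.single_le_sum (f := fun k => (C k ∩ Set.Icc 0 1).indicator (t k) x)
          (fun k _ => hnn k) (Finset.mem_univ j)
  · push Not at hxB
    rw [Finset.sum_eq_zero fun k _ => Set.indicator_of_notMem (hxB k) _]
    exact Finset.sum_nonneg fun k _ => hnn k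
end

section
/- The egalitarian efficiency of an egalitarian optimal allocation is bounded above by 1, below by 1/n, and these bounds are tight. Precisely: (a) for every cake cutting situation with n agents there exists an allocation A with EE(A) ≥ 1/n; (b) for any allocation B and any utilitarian optimal allocation A, n·EE(B) ≤ UE(A); (c) in the situation where agent i's utility is the uniform probability measure on [(i-1)/n, i/n], the allocation A_i = [(i-1)/n, i/n] has EE(A) = 1; (d) in the situation where every agent's utility is Lebesgue measure on [0,1], every allocation A has EE(A) ≤ 1/n. -/
open MeasureTheory ENNReal

/-- An allocation: an `n`-tuple of pairwise disjoint measurable subsets of the cake `[0,1]`. -/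
def IsAllocation {n : ℕ} (A : Fin n → Set ℝ) : Prop :=
  (∀ i, A i ⊆ Set.Icc 0 1) ∧ (∀ i, MeasurableSet (A i)) ∧
    ∀ i j, i ≠ j → Disjoint (A i) (A j)

/-- Moving-knife division along monotone continuous cumulative functions: every `i ∈ s` receives
a half-open interval inside `(a, b]` on which `F i` increases by at least `c`. -/
theorem exists_disjoint_Ioc_of_card_mul_le {ι : Type*} {F : ι → ℝ → ℝ}
    (hF : ∀ i, Continuous (F i)) (hmono : ∀ i, Monotone (F i)) {c : ℝ} (hc : 0 ≤ c) {b : ℝ} :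
    ∀ (k : ℕ) (s : Finset ι) (a : ℝ), s.card = k → a ≤ b →
      (∀ i ∈ s, k * c ≤ F i b - F i a) →
      ∃ l r : ι → ℝ, (∀ i ∈ s, a ≤ l i ∧ r i ≤ b ∧ c ≤ F i (r i) - F i (l i)) ∧
        ∀ i ∈ s, ∀ j ∈ s, i ≠ j → Disjoint (Set.Ioc (l i) (r i)) (Set.Ioc (l j) (r j)) := by
  classical
  intro k
  induction k with
  | zero =>
    intro s a hs _ _
    obtain rfl := Finset.card_eq_zero.mp hs
    exact ⟨0, 0, by simp, by simp⟩
  | succ k ih =>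
    intro s a hs hab h
    have hcut : ∀ i ∈ s, ∃ x ∈ Set.Icc a b, F i x = F i a + c := fun i hi =>
      intermediate_value_Icc hab (hF i).continuousOn
        ⟨by linarith, by
          have := h i hi
          push_cast at this
          nlinarith [mul_nonneg k.cast_nonneg hc]⟩
    choose! x hx hFx using hcut
    obtain ⟨m, hm, hmin⟩ := s.exists_min_image x (Finset.card_pos.mp (by omega))
    obtain ⟨l, r, hlr, hdisj⟩ := ih (s.erase m) (x m)
      (by rw [Finset.card_erase_of_mem hm, hs]; rfl) (hx m hm).2 (by
        intro i hi
        have his := Finset.mem_of_mem_erase hi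
        have h₁ := h i his
        have h₂ := hmono i (hmin i his)
        rw [hFx i his] at h₂
        push_cast at h₁
        linarith)
    have hfirst : ∀ i ∈ s, i ≠ m → Disjoint (Set.Ioc a (x m)) (Set.Ioc (l i) (r i)) :=
      fun i hi hne => Set.disjoint_left.mpr fun y hy hy' =>
        absurd ((hlr i (Finset.mem_erase.mpr ⟨hne, hi⟩)).1.trans_lt hy'.1) (not_lt.mpr hy.2)
    refine ⟨Function.update l m a, Function.update r m (x m), fun i hi => ?_,
      fun i hi j hj hij => ?_⟩
    · obtain rfl | hne := eq_or_ne i m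
      · simp [(hx i hm).2, hFx i hm]
      · obtain ⟨h₁, h₂, h₃⟩ := hlr i (Finset.mem_erase.mpr ⟨hne, hi⟩)
        simpa [hne, h₂, h₃] using (hx m hm).1.trans h₁
    · obtain rfl | hi' := eq_or_ne i m
      · simpa [hij.symm] using hfirst j hj hij.symm
      · obtain rfl | hj' := eq_or_ne j m
        · simpa [hij] using (hfirst i hi hij).symm
        · simpa [hi', hj'] using hdisj i (Finset.mem_erase.mpr ⟨hi', hi⟩) j
            (Finset.mem_erase.mpr ⟨hj', hj⟩) hij

theorem continuous_cdf_of_measure_singleton_eq_zero (μ : Measure ℝ) [IsProbabilityMeasure μ]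
    (h : ∀ x, μ {x} = 0) : Continuous (ProbabilityTheory.cdf μ) := by
  refine continuous_iff_continuousAt.mpr fun x => ?_
  have hmono := ProbabilityTheory.monotone_cdf μ
  rw [hmono.continuousAt_iff_leftLim_eq_rightLim, StieltjesFunction.rightLim_eq]
  refine le_antisymm (hmono.leftLim_le le_rfl) ?_
  have hx := (ProbabilityTheory.cdf μ).measure_singleton x
  rw [ProbabilityTheory.measure_cdf, h x, eq_comm, ENNReal.ofReal_eq_zero] at hx
  linarith

/-- A proportional allocation exists for nonatomic probability measures on the cake. -/
theorem exists_isAllocation_inv_le {n : ℕ} (u : Fin n → Measure ℝ)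
    [∀ i, IsProbabilityMeasure (u i)] (hu : ∀ i, u i (Set.Icc 0 1) = 1)
    (hatom : ∀ i (x : ℝ), u i {x} = 0) :
    ∃ A : Fin n → Set ℝ, IsAllocation A ∧ ∀ i, (n : ℝ≥0∞)⁻¹ ≤ u i (A i) := by
  have hIoc : ∀ i a b, u i (Set.Ioc a b) =
      ENNReal.ofReal (ProbabilityTheory.cdf (u i) b - ProbabilityTheory.cdf (u i) a) :=
    fun i a b => by
      rw [← StieltjesFunction.measure_Ioc, ProbabilityTheory.measure_cdf]
  have htotal : ∀ i, 1 ≤ ProbabilityTheory.cdf (u i) 1 - ProbabilityTheory.cdf (u i) 0 := by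
    intro i
    have : NullSingletonClass (u i) := ⟨hatom i⟩
    rw [← ENNReal.one_le_ofReal, ← hIoc, measure_congr Ioc_ae_eq_Icc, hu]
  obtain ⟨l, r, hlr, hdisj⟩ := exists_disjoint_Ioc_of_card_mul_le
    (fun i => continuous_cdf_of_measure_singleton_eq_zero (u i) (hatom i))
    (fun i => ProbabilityTheory.monotone_cdf (u i)) (c := (n : ℝ)⁻¹) (by positivity)
    n Finset.univ 0 (Finset.card_fin n) zero_le_one
    (fun i _ => mul_inv_le_one.trans (htotal i))
  refine ⟨fun i => Set.Ioc (l i) (r i), ⟨fun i => ?_, fun i => measurableSet_Ioc,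
    fun i j => hdisj i (Finset.mem_univ i) j (Finset.mem_univ j)⟩, fun i => ?_⟩
  · obtain ⟨h₁, h₂, -⟩ := hlr i (Finset.mem_univ i)
    exact Set.Ioc_subset_Icc_self.trans (Set.Icc_subset_Icc h₁ h₂)
  · have hn : (0 : ℝ) < n := Nat.cast_pos.mpr i.pos
    rw [hIoc, ← ENNReal.ofReal_natCast n, ← ENNReal.ofReal_inv_of_pos hn]
    exact ENNReal.ofReal_le_ofReal (hlr i (Finset.mem_univ i)).2.2

theorem card_mul_iInf_le_sum {n : ℕ} (f : Fin n → ℝ≥0∞) : (n : ℝ≥0∞) * ⨅ i, f i ≤ ∑ i, f i := by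
  simpa using Finset.card_nsmul_le_sum Finset.univ f (⨅ i, f i) fun i _ => iInf_le f i

theorem isAllocation_Ico_div {n : ℕ} :
    IsAllocation (fun i : Fin n => Set.Ico (((i : ℕ) : ℝ)/n) ((((i : ℕ) : ℝ) + 1)/n)) := by
  have hlt : ∀ i j : Fin n, i < j →
      Disjoint (Set.Ico (((i : ℕ) : ℝ)/n) ((((i : ℕ) : ℝ) + 1)/n))
        (Set.Ico (((j : ℕ) : ℝ)/n) ((((j : ℕ) : ℝ) + 1)/n)) := by
    intro i j hij
    have h : ((i : ℕ) : ℝ) + 1 ≤ (j : ℕ) := by exact_mod_cast hij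
    exact Set.disjoint_left.mpr fun y hy hy' => absurd (hy.2.trans_le
      ((div_le_div_of_nonneg_right h n.cast_nonneg).trans hy'.1)) (lt_irrefl y)
  refine ⟨fun i => Set.Ico_subset_Icc_self.trans (Set.Icc_subset_Icc (by positivity) ?_),
    fun i => measurableSet_Ico, fun i j hij => ?_⟩
  · have h : ((i : ℕ) : ℝ) + 1 ≤ n := by exact_mod_cast i.isLt
    exact div_le_one_of_le₀ h n.cast_nonneg
  · exact hij.lt_or_gt.elim (hlt i j) fun h => (hlt j i h).symm

theorem smul_volume_restrict_Icc_Ico_div {n : ℕ} (hn : 0 < n) (x : ℝ) :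
    ((n : ℝ≥0∞) • volume.restrict (Set.Icc (x/n) ((x + 1)/n))) (Set.Ico (x/n) ((x + 1)/n)) = 1 := by
  have hn' : (0 : ℝ) < n := Nat.cast_pos.mpr hn
  rw [Measure.smul_apply, Measure.restrict_eq_self _ Set.Ico_subset_Icc_self, Real.volume_Ico,
    smul_eq_mul, ← ENNReal.ofReal_natCast n, ← ENNReal.ofReal_mul hn'.le, ← ENNReal.ofReal_one]
  congr 1
  field_simp
  ring

theorem sum_measure_le_one_of_isAllocation {n : ℕ} (μ : Measure ℝ) [IsProbabilityMeasure μ]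
    {A : Fin n → Set ℝ} (hA : IsAllocation A) : ∑ i, μ (A i) ≤ 1 := by
  rw [← tsum_fintype (L := .unconditional _), ← measure_iUnion (fun i j => hA.2.2 i j) hA.2.1]
  exact prob_le_one

/-- The egalitarian efficiency `EE(A) = min_i u_i(A_i)` of an egalitarian optimal allocation
is bounded above by `1`, below by `1/n`, and these bounds are tight:
(a) an allocation with egalitarian efficiency at least `1/n` always exists;
(b) for any allocation `B` and any utilitarian optimal allocation `A`, `n·EE(B) ≤ UE(A)`;
(c) with disjoint piecewise uniform preferences (agent `i` uniform on `[i/n,(i+1)/n]`),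
the allocation of the blocks attains egalitarian efficiency `1`;
(d) when all agents are Lebesgue measure on `[0,1]`, every allocation has egalitarian
efficiency at most `1/n`. -/
theorem egalitarian_efficiency_bounds (n : ℕ) (hn : 0 < n) :
    (∀ u : Fin n → Measure ℝ, (∀ i, IsProbabilityMeasure (u i)) →
      (∀ i, u i (Set.Icc 0 1) = 1) → (∀ i (x : ℝ), u i {x} = 0) →
      ∃ A : Fin n → Set ℝ, IsAllocation A ∧ (n : ℝ≥0∞)⁻¹ ≤ ⨅ i, u i (A i)) ∧
    (∀ u : Fin n → Measure ℝ, (∀ i, IsProbabilityMeasure (u i)) →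
      (∀ i, u i (Set.Icc 0 1) = 1) → (∀ i (x : ℝ), u i {x} = 0) →
      ∀ A : Fin n → Set ℝ, IsAllocation A →
      (∀ B : Fin n → Set ℝ, IsAllocation B → ∑ i, u i (B i) ≤ ∑ i, u i (A i)) →
      ∀ B : Fin n → Set ℝ, IsAllocation B →
        (n : ℝ≥0∞) * ⨅ i, u i (B i) ≤ ∑ i, u i (A i)) ∧
    (IsAllocation (fun i : Fin n => Set.Ico (((i : ℕ) : ℝ)/n) ((((i : ℕ) : ℝ) + 1)/n)) ∧
      ⨅ i : Fin n,
        ((n : ℝ≥0∞) • volume.restrict (Set.Icc (((i : ℕ) : ℝ)/n) ((((i : ℕ) : ℝ) + 1)/n)))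
          (Set.Ico (((i : ℕ) : ℝ)/n) ((((i : ℕ) : ℝ) + 1)/n)) = 1) ∧
    (∀ A : Fin n → Set ℝ, IsAllocation A →
      ⨅ i, (volume.restrict (Set.Icc (0:ℝ) 1)) (A i) ≤ (n : ℝ≥0∞)⁻¹) := by
  refine ⟨fun u _ hu hatom => ?_, fun u _ _ _ A _ hopt B hB =>
    (card_mul_iInf_le_sum _).trans (hopt B hB), ⟨isAllocation_Ico_div, ?_⟩, fun A hA => ?_⟩
  · obtain ⟨A, hA, h⟩ := exists_isAllocation_inv_le u hu hatom
    exact ⟨A, hA, le_iInf h⟩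
  · have : Nonempty (Fin n) := ⟨⟨0, hn⟩⟩
    simp only [smul_volume_restrict_Icc_Ico_div hn, iInf_const]
  · have : IsProbabilityMeasure (volume.restrict (Set.Icc (0 : ℝ) 1)) := ⟨by simp⟩
    rw [ENNReal.le_inv_iff_mul_le, mul_comm]
    exact (card_mul_iInf_le_sum _).trans (sum_measure_le_one_of_isAllocation _ hA)
end

section
/- A reduced Length Game profile with well behaved agents is in equilibrium only if every agent's strategy includes their uncontested region: if (S_1,...,S_n) is a reduced, well behaved profile in equilibrium, then for every agent i the part of i's uncontested region not claimed by i is null, i.e. |(P_i \ ⋃_{j ≠ i} P_j) \ S_i| = 0. -/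
open MeasureTheory

/-- A piecewise uniform preference set: a finite union of closed intervals inside `[0,1]`
with positive total length. -/
def PWUniform (P : Set ℝ) : Prop :=
  (∃ (m : ℕ) (a b : Fin m → ℝ), P = ⋃ k, Set.Icc (a k) (b k)) ∧
    P ⊆ Set.Icc 0 1 ∧ 0 < volume P

/-- Piecewise uniform utility: `u_P(X) = |X ∩ P| / |P|`. -/
noncomputable def pwUtil (P X : Set ℝ) : ℝ :=
  (volume (X ∩ P)).toReal / (volume P).toReal

/-- The Length Game precedence order: `i ≺ j` iff `|S i| < |S j|`, or `|S i| = |S j|`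
and `i < j`. -/
def lgPrec {n : ℕ} (S : Fin n → Set ℝ) (i j : Fin n) : Prop :=
  volume (S i) < volume (S j) ∨ (volume (S i) = volume (S j) ∧ i < j)

/-- The Length Game allocation: `A i = S i \ ⋃_{j ≺ i} S j`. -/
def lgAlloc {n : ℕ} (S : Fin n → Set ℝ) (i : Fin n) : Set ℝ :=
  S i \ ⋃ (j) (_ : lgPrec S j i), S j

/-- A valid Length Game strategy: a measurable subset of the cake `[0,1]`. -/
def IsStrategy (S : Set ℝ) : Prop :=
  MeasurableSet S ∧ S ⊆ Set.Icc 0 1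

/-- A profile is in equilibrium if no agent can strictly increase their utility by
unilaterally switching to another strategy. -/
def lgEquilibrium {n : ℕ} (P S : Fin n → Set ℝ) : Prop :=
  ¬ ∃ (i : Fin n) (S' : Set ℝ), IsStrategy S' ∧
    pwUtil (P i) (lgAlloc S i) < pwUtil (P i) (lgAlloc (Function.update S i S') i)

theorem PWUniform.measurableSet {P : Set ℝ} (h : PWUniform P) : MeasurableSet P := by
  obtain ⟨⟨m, a, b, rfl⟩, -, -⟩ := h
  exact MeasurableSet.iUnion fun k => measurableSet_Icc

theorem PWUniform.volume_ne_top {P : Set ℝ} (h : PWUniform P) : volume P ≠ ⊤ :=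
  measure_ne_top_of_subset h.2.1 measure_Icc_lt_top.ne

theorem not_lgPrec_self {n : ℕ} (S : Fin n → Set ℝ) (i : Fin n) : ¬ lgPrec S i i := by
  simp [lgPrec]

theorem lgPrec_or_lgPrec_of_ne {n : ℕ} (S : Fin n → Set ℝ) {i j : Fin n} (h : i ≠ j) :
    lgPrec S i j ∨ lgPrec S j i := by
  unfold lgPrec
  rcases lt_trichotomy (volume (S i)) (volume (S j)) with hv | hv | hv
  · exact Or.inl (Or.inl hv)
  · rcases lt_or_gt_of_ne h with hl | hl
    · exact Or.inl (Or.inr ⟨hv, hl⟩)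
    · exact Or.inr (Or.inr ⟨hv.symm, hl⟩)
  · exact Or.inr (Or.inl hv)

/-- The strategies in a reduced profile are pairwise disjoint. -/
theorem disjoint_of_eq_lgAlloc {n : ℕ} {S : Fin n → Set ℝ} (h : ∀ i, S i = lgAlloc S i)
    {i j : Fin n} (hij : i ≠ j) : Disjoint (S i) (S j) := by
  have key : ∀ {k l : Fin n}, lgPrec S k l → Disjoint (S k) (S l) := by
    intro k l hkl
    rw [Set.disjoint_left]
    intro x hk hl
    rw [h l] at hl
    exact hl.2 (Set.mem_iUnion₂.2 ⟨k, hkl, hk⟩)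
  rcases lgPrec_or_lgPrec_of_ne S hij with hp | hp
  · exact key hp
  · exact (key hp).symm

/-- An agent whose strategy meets no other strategy receives all of it. -/
theorem lgAlloc_update_of_disjoint {n : ℕ} {S : Fin n → Set ℝ} {i : Fin n} {T : Set ℝ}
    (h : ∀ j, j ≠ i → Disjoint T (S j)) : lgAlloc (Function.update S i T) i = T := by
  unfold lgAlloc
  rw [Function.update_self, sdiff_eq_left, Set.disjoint_iUnion₂_right]
  intro j hj
  have hji : j ≠ i := by
    rintro rfl
    exact not_lgPrec_self _ _ hj
  rw [Function.update_of_ne hji]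
  exact h j hji

/-- A reduced Length Game profile with well behaved agents is in equilibrium only if
every agent's strategy includes (up to a null set) their uncontested region
`P i \ ⋃_{j ≠ i} P j`. -/
theorem length_game_equilibrium_claims_uncontested {n : ℕ}
    (P : Fin n → Set ℝ) (hP : ∀ i, PWUniform (P i))
    (S : Fin n → Set ℝ) (hS : ∀ i, IsStrategy (S i))
    (hreduced : ∀ i, S i = lgAlloc S i)
    (hwb : ∀ i, S i ⊆ P i)
    (heq : lgEquilibrium P S) :
    ∀ i, volume ((P i \ ⋃ (j) (_ : j ≠ i), P j) \ S i) = 0 := by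
  intro i
  by_contra hT
  set T := (P i \ ⋃ (j) (_ : j ≠ i), P j) \ S i
  have hTP : T ⊆ P i := fun x hx => hx.1.1
  have hTm : MeasurableSet T :=
    ((hP i).measurableSet.diff (MeasurableSet.iUnion fun j => MeasurableSet.iUnion fun _ =>
      (hP j).measurableSet)).diff (hS i).1
  have hTS : Disjoint (S i) T := Set.disjoint_sdiff_right
  have hUP : S i ∪ T ⊆ P i := Set.union_subset (hwb i) hTP
  have hdisj : ∀ j, j ≠ i → Disjoint (S i ∪ T) (S j) := by
    intro j hj
    refine (disjoint_of_eq_lgAlloc hreduced hj.symm).union_left ?_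
    rw [Set.disjoint_left]
    intro x hx hxj
    exact hx.1.2 (Set.mem_iUnion₂.2 ⟨j, hj, hwb j hxj⟩)
  refine heq ⟨i, S i ∪ T, ⟨(hS i).1.union hTm, hUP.trans (hP i).2.1⟩, ?_⟩
  have hfin := (hP i).volume_ne_top
  rw [lgAlloc_update_of_disjoint hdisj, ← hreduced i]
  unfold pwUtil
  rw [Set.inter_eq_left.2 hUP, Set.inter_eq_left.2 (hwb i)]
  refine div_lt_div_of_pos_right ?_ (ENNReal.toReal_pos (hP i).2.2.ne' hfin)
  refine ENNReal.toReal_strict_mono (measure_ne_top_of_subset hUP hfin) ?_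
  rw [measure_union hTS hTm]
  exact ENNReal.lt_add_right (measure_ne_top_of_subset (hwb i) hfin) hT
end

section
/- All well behaved equilibria of the Length Game are envy free: if (S_1,...,S_n) is a well behaved profile in equilibrium with resulting allocation (A_1,...,A_n), then u_i(A_i) ≥ u_i(A_j) for all agents i, j. -/
open MeasureTheory

/-- A subset of `[0,1]` has measurable parts of every measure up to its own. -/
lemma exists_measurableSet_subset_measureReal_eq {T : Set ℝ} (hT : MeasurableSet T)
    (hT01 : T ⊆ Set.Icc 0 1) {c : ℝ} (hc0 : 0 ≤ c) (hc : c ≤ volume.real T) :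
    ∃ T' ⊆ T, MeasurableSet T' ∧ volume.real T' = c := by
  have hfin (x : ℝ) : volume (T ∩ Set.Iic x) ≠ ⊤ :=
    measure_ne_top_of_subset (Set.inter_subset_left.trans hT01) (by simp)
  have hcont : Continuous fun x : ℝ => volume.real (T ∩ Set.Iic x) := by
    refine (LipschitzWith.of_le_add fun x y => ?_).continuous
    have hsub : T ∩ Set.Iic x ⊆ (T ∩ Set.Iic y) ∪ Set.uIcc y x := by
      intro z hz
      rcases le_or_gt z y with h | h
      · exact Or.inl ⟨hz.1, h⟩
      · exact Or.inr (Set.Icc_subset_uIcc ⟨h.le, hz.2⟩)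
    calc volume.real (T ∩ Set.Iic x)
        ≤ volume.real ((T ∩ Set.Iic y) ∪ Set.uIcc y x) :=
          measureReal_mono hsub (measure_union_ne_top (hfin y) (by simp))
      _ ≤ volume.real (T ∩ Set.Iic y) + volume.real (Set.uIcc y x) := measureReal_union_le _ _
      _ = volume.real (T ∩ Set.Iic y) + dist x y := by simp [measureReal_def, Real.dist_eq]
  have hlow : T ∩ Set.Iic (-1) = ∅ := by
    ext z
    simp only [Set.mem_inter_iff, Set.mem_Iic, Set.mem_empty_iff_false, iff_false, not_and]
    intro hz h
    linarith [(hT01 hz).1]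
  have hhigh : T ∩ Set.Iic 1 = T := Set.inter_eq_left.mpr fun z hz => (hT01 hz).2
  obtain ⟨x, -, hx⟩ := intermediate_value_Icc (by norm_num : (-1 : ℝ) ≤ 1) hcont.continuousOn
    (show c ∈ Set.Icc _ _ by simp [hlow, hhigh, hc0, hc])
  exact ⟨T ∩ Set.Iic x, Set.inter_subset_left, hT.inter measurableSet_Iic, hx⟩

lemma measurableSet_lgAlloc {n : ℕ} {S : Fin n → Set ℝ} (hS : ∀ i, MeasurableSet (S i))
    (i : Fin n) : MeasurableSet (lgAlloc S i) :=
  (hS i).diff (MeasurableSet.iUnion fun j => MeasurableSet.iUnion fun _ => hS j)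

/-- An agent who switches to a part of another agent's allocation that is strictly shorter than
that agent's strategy receives all of it. -/
lemma lgAlloc_update_eq_of_subset {n : ℕ} {S : Fin n → Set ℝ} {i j : Fin n} {T : Set ℝ}
    (hT : T ⊆ lgAlloc S j) (hlt : volume T < volume (S j)) :
    lgAlloc (Function.update S i T) i = T := by
  refine (Set.sdiff_subset.trans (by simp)).antisymm fun x hx => ⟨by simpa using hx, ?_⟩
  simp only [Set.mem_iUnion, not_exists]
  intro k hk hxk
  rcases eq_or_ne k i with rfl | hki
  · simp [lgPrec] at hk
  · simp only [lgPrec, Function.update_of_ne hki, Function.update_self] at hk hxk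
    have hkT : volume (S k) ≤ volume T := hk.elim le_of_lt fun h => h.1.le
    exact (hT hx).2 (Set.mem_biUnion (Or.inl (hkT.trans_lt hlt) : lgPrec S k j) hxk)

/-- All well behaved equilibria of the Length Game are envy free. -/
theorem length_game_equilibrium_envy_free {n : ℕ}
    (P : Fin n → Set ℝ) (hP : ∀ i, PWUniform (P i))
    (S : Fin n → Set ℝ) (hS : ∀ i, IsStrategy (S i))
    (hwb : ∀ i, S i ⊆ P i)
    (heq : lgEquilibrium P S) :
    ∀ i j, pwUtil (P i) (lgAlloc S j) ≤ pwUtil (P i) (lgAlloc S i) := by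
  intro i j
  by_contra! hlt
  have hPtop : volume (P i) ≠ ⊤ := measure_ne_top_of_subset (hP i).2.1 (by simp)
  have hPpos : 0 < (volume (P i)).toReal := ENNReal.toReal_pos (hP i).2.2.ne' hPtop
  have hgap : volume.real (lgAlloc S i ∩ P i) < volume.real (lgAlloc S j ∩ P i) :=
    (div_lt_div_iff_of_pos_right hPpos).mp hlt
  have hPmeas : MeasurableSet (P i) := by
    obtain ⟨m, a, b, hab⟩ := (hP i).1
    rw [hab]
    exact MeasurableSet.iUnion fun k => measurableSet_Icc
  obtain ⟨c, hc₁, hc₂⟩ := exists_between hgap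
  obtain ⟨T, hTsub, hTmeas, hTc⟩ := exists_measurableSet_subset_measureReal_eq
    ((measurableSet_lgAlloc (fun k => (hS k).1) j).inter hPmeas)
    (Set.inter_subset_right.trans (hP i).2.1) (measureReal_nonneg.trans hc₁.le) hc₂.le
  have hT01 : T ⊆ Set.Icc 0 1 := hTsub.trans (Set.inter_subset_right.trans (hP i).2.1)
  have hTlt : volume T < volume (S j) := by
    have hTtop : volume T ≠ ⊤ := measure_ne_top_of_subset hT01 (by simp)
    have hjtop : volume (S j) ≠ ⊤ := measure_ne_top_of_subset (hS j).2 (by simp)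
    refine (ENNReal.toReal_lt_toReal hTtop hjtop).mp ?_
    exact (hTc.trans_lt hc₂).trans_le
      (measureReal_mono (Set.inter_subset_left.trans Set.sdiff_subset) hjtop)
  refine heq ⟨i, T, ⟨hTmeas, hT01⟩, ?_⟩
  rw [lgAlloc_update_eq_of_subset (hTsub.trans Set.inter_subset_left) hTlt, pwUtil, pwUtil,
    Set.inter_eq_left.mpr (hTsub.trans Set.inter_subset_right)]
  exact (div_lt_div_iff_of_pos_right hPpos).mpr (hc₁.trans_eq hTc.symm)
end
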